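/- The symmetric monoidal category Chu(C,Ω) (with tensor ⊠) is monoidal closed: for every object A of Chu(C,Ω) the functor A ⊠ − has a right adjoint A ⊸ −, where (A ⊸ B)⁺ is the pullback of the cospan [A⁺, B⁺] ⟶ [A⁺ ⊗ B⁻, Ω] ⟵ [B⁻, A⁻] (the legs being the transposes of evaluation followed by e_B, respectively evaluation followed by e_A, modulo symmetry), (A ⊸ B)⁻ = A⁺ ⊗ B⁻, and the pairing e_{A ⊸ B} : (A ⊸ B)⁺ ⊗ (A⁺ ⊗ B⁻) ⟶ Ω is the transpose of the common composite (A ⊸ B)⁺ ⟶ [A⁺ ⊗ B⁻, Ω] of the pullback. -/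

import Mathlib

open CategoryTheory MonoidalCategory Limits

universe v u

variable (C : Type u) [Category.{v} C] [MonoidalCategory C] [SymmetricCategory C] (Ω : C)

/-- An object of the Chu construction `Chu(C, Ω)`: a pair of objects of `C`
together with a pairing into `Ω`. -/
structure Chu : Type (max u v) where
  pos : C
  neg : C
  pair : pos ⊗ neg ⟶ Ω

variable {C Ω}

/-- A morphism of the Chu construction. -/
@[ext]
structure ChuHom (A B : Chu C Ω) : Type v where
  pos : A.pos ⟶ B.pos
  neg : B.neg ⟶ A.neg
  compat : A.pos ◁ neg ≫ A.pair = pos ▷ B.neg ≫ B.pair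

instance : Category (Chu C Ω) where
  Hom := ChuHom
  id A :=
    { pos := 𝟙 A.pos
      neg := 𝟙 A.neg
      compat := by simp }
  comp {A B E} f g :=
    { pos := f.pos ≫ g.pos
      neg := g.neg ≫ f.neg
      compat := by
        calc A.pos ◁ (g.neg ≫ f.neg) ≫ A.pair
            = A.pos ◁ g.neg ≫ (A.pos ◁ f.neg ≫ A.pair) := by
              rw [MonoidalCategory.whiskerLeft_comp, Category.assoc]
          _ = A.pos ◁ g.neg ≫ (f.pos ▷ B.neg ≫ B.pair) := by rw [f.compat]
          _ = (A.pos ◁ g.neg ≫ f.pos ▷ B.neg) ≫ B.pair := by rw [Category.assoc]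
          _ = (f.pos ▷ E.neg ≫ B.pos ◁ g.neg) ≫ B.pair := by rw [whisker_exchange]
          _ = f.pos ▷ E.neg ≫ (g.pos ▷ E.neg ≫ E.pair) := by
              rw [Category.assoc, g.compat]
          _ = (f.pos ≫ g.pos) ▷ E.neg ≫ E.pair := by
              rw [MonoidalCategory.comp_whiskerRight, Category.assoc] }
  id_comp f := by apply ChuHom.ext <;> simp
  comp_id f := by apply ChuHom.ext <;> simp
  assoc f g h := by apply ChuHom.ext <;> simp

variable [MonoidalClosed C] [Limits.HasPullbacks C]

/-- The leg `[A⁺, B⁻] ⟶ [A⁺ ⊗ B⁺, Ω]`: the transpose of the composite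
`[A⁺,B⁻] ⊗ A⁺ ⊗ B⁺ ⟶ B⁻ ⊗ B⁺ ⟶ Ω` (evaluation followed by `e_B`, modulo symmetry). -/
noncomputable def chuTensorLegB (A B : Chu C Ω) :
    (ihom A.pos).obj B.neg ⟶ (ihom (A.pos ⊗ B.pos)).obj Ω :=
  MonoidalClosed.curry
    ((α_ A.pos B.pos ((ihom A.pos).obj B.neg)).hom ≫
      A.pos ◁ (β_ B.pos ((ihom A.pos).obj B.neg)).hom ≫
      (α_ A.pos ((ihom A.pos).obj B.neg) B.pos).inv ≫
      ((ihom.ev A.pos).app B.neg) ▷ B.pos ≫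
      (β_ B.neg B.pos).hom ≫ B.pair)

/-- The leg `[B⁺, A⁻] ⟶ [A⁺ ⊗ B⁺, Ω]`: the transpose of the composite
`[B⁺,A⁻] ⊗ A⁺ ⊗ B⁺ ⟶ A⁻ ⊗ A⁺ ⟶ Ω` (evaluation followed by `e_A`, modulo symmetry). -/
noncomputable def chuTensorLegA (A B : Chu C Ω) :
    (ihom B.pos).obj A.neg ⟶ (ihom (A.pos ⊗ B.pos)).obj Ω :=
  MonoidalClosed.curry
    ((α_ A.pos B.pos ((ihom B.pos).obj A.neg)).hom ≫
      A.pos ◁ ((ihom.ev B.pos).app A.neg) ≫ A.pair)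

/-- The negative part of the tensor product: the pullback
`[A⁺,B⁻] ×_{[A⁺⊗B⁺,Ω]} [B⁺,A⁻]`. -/
noncomputable def chuTensorNeg (A B : Chu C Ω) : C :=
  Limits.pullback (chuTensorLegB A B) (chuTensorLegA A B)

/-- The tensor product `A ⊠ B` in `Chu(C,Ω)`: `(A ⊠ B)⁺ = A⁺ ⊗ B⁺`,
`(A ⊠ B)⁻ = [A⁺,B⁻] ×_{[A⁺⊗B⁺,Ω]} [B⁺,A⁻]`, with pairing the transpose of the
common composite `(A ⊠ B)⁻ ⟶ [A⁺ ⊗ B⁺, Ω]` of the pullback. -/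
noncomputable def Chu.tensorObj (A B : Chu C Ω) : Chu C Ω where
  pos := A.pos ⊗ B.pos
  neg := chuTensorNeg A B
  pair := MonoidalClosed.uncurry
    (Limits.pullback.fst (chuTensorLegB A B) (chuTensorLegA A B) ≫ chuTensorLegB A B)

/-- The unit object `(I, Ω, λ)` of `Chu(C,Ω)`. -/
def chuUnit : Chu C Ω where
  pos := 𝟙_ C
  neg := Ω
  pair := (λ_ Ω).hom

/-- The leg `[A⁺, B⁺] ⟶ [A⁺ ⊗ B⁻, Ω]`: the transpose of evaluation followed by
`e_B`, modulo symmetry. -/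
noncomputable def chuHomLegB (A B : Chu C Ω) :
    (ihom A.pos).obj B.pos ⟶ (ihom (A.pos ⊗ B.neg)).obj Ω :=
  MonoidalClosed.curry
    ((α_ A.pos B.neg ((ihom A.pos).obj B.pos)).hom ≫
      A.pos ◁ (β_ B.neg ((ihom A.pos).obj B.pos)).hom ≫
      (α_ A.pos ((ihom A.pos).obj B.pos) B.neg).inv ≫
      ((ihom.ev A.pos).app B.pos) ▷ B.neg ≫ B.pair)

/-- The leg `[B⁻, A⁻] ⟶ [A⁺ ⊗ B⁻, Ω]`: the transpose of evaluation followed by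
`e_A`, modulo symmetry. -/
noncomputable def chuHomLegA (A B : Chu C Ω) :
    (ihom B.neg).obj A.neg ⟶ (ihom (A.pos ⊗ B.neg)).obj Ω :=
  MonoidalClosed.curry
    ((α_ A.pos B.neg ((ihom B.neg).obj A.neg)).hom ≫
      A.pos ◁ ((ihom.ev B.neg).app A.neg) ≫ A.pair)

/-- The internal hom `A ⊸ B` of `Chu(C,Ω)`: `(A ⊸ B)⁺` is the pullback of
`[A⁺,B⁺] ⟶ [A⁺ ⊗ B⁻, Ω] ⟵ [B⁻,A⁻]`, `(A ⊸ B)⁻ = A⁺ ⊗ B⁻`, and the pairing is the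
transpose of the common composite `(A ⊸ B)⁺ ⟶ [A⁺ ⊗ B⁻, Ω]` of the pullback
(modulo symmetry). -/
noncomputable def Chu.homObj (A B : Chu C Ω) : Chu C Ω where
  pos := Limits.pullback (chuHomLegB A B) (chuHomLegA A B)
  neg := A.pos ⊗ B.neg
  pair := (β_ (Limits.pullback (chuHomLegB A B) (chuHomLegA A B)) (A.pos ⊗ B.neg)).hom ≫
    MonoidalClosed.uncurry
      (Limits.pullback.fst (chuHomLegB A B) (chuHomLegA A B) ≫ chuHomLegB A B)

namespace Chu

set_option linter.unusedSectionVars false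

section Rotation

/-- The cyclic rotation `A ⊗ (B ⊗ Y) ⟶ B ⊗ (Y ⊗ A)`. -/
def rot (A B Y : C) : A ⊗ (B ⊗ Y) ⟶ B ⊗ (Y ⊗ A) :=
  (β_ A (B ⊗ Y)).hom ≫ (α_ B Y A).hom

instance (A B Y : C) : IsIso (rot A B Y) := by
  unfold rot; infer_instance

lemma rot_eq (A B Y : C) :
    rot A B Y = (α_ A B Y).inv ≫ (β_ A B).hom ▷ Y ≫ (α_ B A Y).hom ≫ B ◁ (β_ A Y).hom := by
  simp [rot]

lemma rot_braiding (A B Y : C) :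
    rot A B Y ≫ B ◁ (β_ Y A).hom = (α_ A B Y).inv ≫ (β_ A B).hom ▷ Y ≫ (α_ B A Y).hom := by
  simp [rot_eq, ← MonoidalCategory.whiskerLeft_comp]

lemma rot_naturality {A A' B B' : C} (f : A ⟶ A') (g : B ⟶ B') (Y : C) :
    A ◁ g ▷ Y ≫ f ▷ (B' ⊗ Y) ≫ rot A' B' Y = rot A B Y ≫ B ◁ Y ◁ f ≫ g ▷ (Y ⊗ A') := by
  simp only [rot, BraidedCategory.braiding_naturality_left_assoc,
    BraidedCategory.braiding_naturality_right_assoc, tensor_whiskerLeft, Category.assoc,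
    Iso.inv_hom_id, Category.comp_id, associator_naturality_left_assoc, whisker_exchange]

lemma rot_naturality_right (A B : C) {Y Y' : C} (h : Y ⟶ Y') :
    A ◁ B ◁ h ≫ rot A B Y' = rot A B Y ≫ B ◁ h ▷ A := by
  simp only [rot, BraidedCategory.braiding_naturality_right_assoc, Category.assoc,
    associator_naturality_middle]

lemma rot_tensor_middle (A B E Y : C) :
    A ◁ (α_ B E Y).inv ≫ rot A (B ⊗ E) Y ≫ (α_ B E (Y ⊗ A)).hom =
      rot A B (E ⊗ Y) ≫ B ◁ (α_ E Y A).hom := by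
  simp only [rot, BraidedCategory.braiding_naturality_right_assoc, Category.assoc]
  monoidal

lemma rot_braiding_comp (A B W : C) :
    (α_ A B W).hom ≫ rot A B W ≫ (β_ B (W ⊗ A)).hom = (β_ (A ⊗ B) W).hom ≫ (α_ W A B).inv := by
  rw [rot_eq]
  simp only [Category.assoc, Iso.hom_inv_id_assoc, BraidedCategory.braiding_naturality_right]
  simp [← MonoidalCategory.comp_whiskerRight_assoc]

lemma rot_rot (A B E Y : C) :
    (α_ A B (E ⊗ Y)).hom ≫ rot A B (E ⊗ Y) ≫ B ◁ (α_ E Y A).hom ≫ rot B E (Y ⊗ A) =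
      rot (A ⊗ B) E Y ≫ E ◁ (α_ Y A B).inv := by
  have h := rot_braiding_comp A B (E ⊗ Y)
  rw [rot.eq_1 B, BraidedCategory.braiding_naturality_right_assoc, reassoc_of% h]
  simp only [rot, Category.assoc]
  monoidal

lemma rot_braiding_rot (A B Y : C) :
    rot A B Y ≫ B ◁ (β_ Y A).hom ≫ rot B A Y = A ◁ (β_ B Y).hom := by
  rw [← Category.assoc, rot_braiding, rot_eq]
  simp [← MonoidalCategory.comp_whiskerRight_assoc]

lemma whiskerLeft_braiding_comp_braiding (A B Y : C) :
    A ◁ (β_ B Y).hom ≫ (α_ A Y B).inv ≫ (β_ (A ⊗ Y) B).hom =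
      (α_ A B Y).inv ≫ (β_ A B).hom ▷ Y ≫ (α_ B A Y).hom := by
  simp [← MonoidalCategory.whiskerLeft_comp_assoc]

end Rotation

/-- The pairing `A⁺ ⊗ Y ⟶ Ω` of `A⁺` with a generalized element of `A⁻`. -/
def pairing (A : Chu C Ω) {Y : C} (x : Y ⟶ A.neg) : A.pos ⊗ Y ⟶ Ω :=
  A.pos ◁ x ≫ A.pair

lemma pairing_comp (A : Chu C Ω) {Y Z : C} (f : Z ⟶ Y) (x : Y ⟶ A.neg) :
    A.pairing (f ≫ x) = A.pos ◁ f ≫ A.pairing x := by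
  simp [pairing]

lemma pairing_neg {A B : Chu C Ω} (f : A ⟶ B) {Y : C} (x : Y ⟶ B.neg) :
    A.pairing (x ≫ ChuHom.neg f) = ChuHom.pos f ▷ Y ≫ B.pairing x := by
  simp only [pairing, MonoidalCategory.whiskerLeft_comp, Category.assoc]
  rw [ChuHom.compat f, whisker_exchange_assoc]

lemma hom_ext {A B : Chu C Ω} {f g : A ⟶ B} (hp : ChuHom.pos f = ChuHom.pos g)
    (hn : ChuHom.neg f = ChuHom.neg g) : f = g :=
  ChuHom.ext hp hn

/-- A morphism of Chu objects from its components, with compatibility stated by `pairing`. -/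
def homMk {A B : Chu C Ω} (p : A.pos ⟶ B.pos) (n : B.neg ⟶ A.neg)
    (w : A.pairing n = p ▷ B.neg ≫ B.pairing (𝟙 _)) : A ⟶ B :=
  ChuHom.mk p n (by simpa [pairing] using w)

@[simp] lemma homMk_pos {A B : Chu C Ω} (p : A.pos ⟶ B.pos) (n : B.neg ⟶ A.neg)
    (w : A.pairing n = p ▷ B.neg ≫ B.pairing (𝟙 _)) : ChuHom.pos (homMk p n w) = p := rfl

@[simp] lemma homMk_neg {A B : Chu C Ω} (p : A.pos ⟶ B.pos) (n : B.neg ⟶ A.neg)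
    (w : A.pairing n = p ▷ B.neg ≫ B.pairing (𝟙 _)) : ChuHom.neg (homMk p n w) = n := rfl

@[simp] lemma comp_pos {A B E : Chu C Ω} (f : A ⟶ B) (g : B ⟶ E) :
    ChuHom.pos (f ≫ g) = ChuHom.pos f ≫ ChuHom.pos g := rfl

@[simp] lemma comp_neg {A B E : Chu C Ω} (f : A ⟶ B) (g : B ⟶ E) :
    ChuHom.neg (f ≫ g) = ChuHom.neg g ≫ ChuHom.neg f := rfl

@[simp] lemma id_pos (A : Chu C Ω) : ChuHom.pos (𝟙 A) = 𝟙 A.pos := rfl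

@[simp] lemma id_neg (A : Chu C Ω) : ChuHom.neg (𝟙 A) = 𝟙 A.neg := rfl

section TensorNeg

variable {A B : Chu C Ω} {Y Z : C}

/-- The projection `(A ⊠ B)⁻ ⟶ [A⁺, B⁻]`. -/
noncomputable def negFst (A B : Chu C Ω) : chuTensorNeg A B ⟶ (ihom A.pos).obj B.neg :=
  pullback.fst (chuTensorLegB A B) (chuTensorLegA A B)

/-- The projection `(A ⊠ B)⁻ ⟶ [B⁺, A⁻]`. -/
noncomputable def negSnd (A B : Chu C Ω) : chuTensorNeg A B ⟶ (ihom B.pos).obj A.neg :=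
  pullback.snd (chuTensorLegB A B) (chuTensorLegA A B)

lemma negFst_comp_legB (A B : Chu C Ω) :
    negFst A B ≫ chuTensorLegB A B = negSnd A B ≫ chuTensorLegA A B :=
  pullback.condition

/-- The component `Y ⊗ A⁺ ⟶ B⁻` of a generalized element of `(A ⊠ B)⁻`. -/
noncomputable def fst (x : Y ⟶ chuTensorNeg A B) : Y ⊗ A.pos ⟶ B.neg :=
  (β_ Y A.pos).hom ≫ MonoidalClosed.uncurry (x ≫ negFst A B)

/-- The component `B⁺ ⊗ Y ⟶ A⁻` of a generalized element of `(A ⊠ B)⁻`. -/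
noncomputable def snd (x : Y ⟶ chuTensorNeg A B) : B.pos ⊗ Y ⟶ A.neg :=
  MonoidalClosed.uncurry (x ≫ negSnd A B)

lemma fst_comp (f : Z ⟶ Y) (x : Y ⟶ chuTensorNeg A B) :
    fst (f ≫ x) = f ▷ A.pos ≫ fst x := by
  rw [fst, fst, Category.assoc, MonoidalClosed.uncurry_natural_left,
    BraidedCategory.braiding_naturality_left_assoc]

lemma snd_comp (f : Z ⟶ Y) (x : Y ⟶ chuTensorNeg A B) :
    snd (f ≫ x) = B.pos ◁ f ≫ snd x := by
  rw [snd, snd, Category.assoc, MonoidalClosed.uncurry_natural_left]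

lemma neg_ext {x y : Y ⟶ chuTensorNeg A B} (h₁ : fst x = fst y) (h₂ : snd x = snd y) :
    x = y := by
  apply pullback.hom_ext
  · apply MonoidalClosed.uncurry_injective
    exact (cancel_epi _).1 h₁
  · exact MonoidalClosed.uncurry_injective h₂

lemma uncurry_comp_chuTensorLegA (x : Y ⟶ (ihom B.pos).obj A.neg) :
    MonoidalClosed.uncurry (x ≫ chuTensorLegA A B) =
      (α_ A.pos B.pos Y).hom ≫ A.pairing (MonoidalClosed.uncurry x) := by
  simp [chuTensorLegA, MonoidalClosed.uncurry_natural_left, pairing,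
    MonoidalClosed.uncurry_eq x]

lemma uncurry_comp_chuTensorLegB (x : Y ⟶ (ihom A.pos).obj B.neg) :
    MonoidalClosed.uncurry (x ≫ chuTensorLegB A B) =
      (α_ A.pos B.pos Y).hom ≫ rot A.pos B.pos Y ≫
        B.pairing ((β_ Y A.pos).hom ≫ MonoidalClosed.uncurry x) := by
  simp [chuTensorLegB, MonoidalClosed.uncurry_natural_left, pairing,
    MonoidalClosed.uncurry_eq x, -BraidedCategory.braiding_tensor_right_hom,
    -BraidedCategory.braiding_tensor_left_hom]
  rw [reassoc_of% rot_braiding A.pos B.pos Y,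
    reassoc_of% whiskerLeft_braiding_comp_braiding A.pos B.pos ((ihom A.pos).obj B.neg)]
  rw [associator_inv_naturality_right_assoc, whisker_exchange_assoc,
    associator_naturality_right_assoc]

/-- A generalized element of `(A ⊠ B)⁻` from compatible components. -/
noncomputable def lift (g : Y ⊗ A.pos ⟶ B.neg) (h : B.pos ⊗ Y ⟶ A.neg)
    (w : A.pairing h = rot A.pos B.pos Y ≫ B.pairing g) :
    Y ⟶ chuTensorNeg A B :=
  pullback.lift (MonoidalClosed.curry ((β_ A.pos Y).hom ≫ g)) (MonoidalClosed.curry h) (by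
    apply MonoidalClosed.uncurry_injective
    rw [uncurry_comp_chuTensorLegA, uncurry_comp_chuTensorLegB]
    simp [w])

@[simp] lemma fst_lift (g : Y ⊗ A.pos ⟶ B.neg) (h : B.pos ⊗ Y ⟶ A.neg)
    (w : A.pairing h = rot A.pos B.pos Y ≫ B.pairing g) :
    fst (lift g h w) = g := by
  have h₁ : lift g h w ≫ negFst A B = _ := pullback.lift_fst _ _ _
  rw [fst, h₁]
  simp

@[simp] lemma snd_lift (g : Y ⊗ A.pos ⟶ B.neg) (h : B.pos ⊗ Y ⟶ A.neg)
    (w : A.pairing h = rot A.pos B.pos Y ≫ B.pairing g) :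
    snd (lift g h w) = h := by
  have h₁ : lift g h w ≫ negSnd A B = _ := pullback.lift_snd _ _ _
  rw [snd, h₁]
  simp

/-- A copy of `tensorObj A B` whose components unfold. -/
noncomputable abbrev tens (A B : Chu C Ω) : Chu C Ω where
  pos := A.pos ⊗ B.pos
  neg := chuTensorNeg A B
  pair := (tensorObj A B).pair

lemma pairing_tens (x : Y ⟶ chuTensorNeg A B) :
    (tens A B).pairing x = (α_ A.pos B.pos Y).hom ≫ A.pairing (snd x) := by
  rw [snd, ← uncurry_comp_chuTensorLegA, Category.assoc, ← negFst_comp_legB,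
    MonoidalClosed.uncurry_natural_left]
  rfl

lemma pairing_snd (x : Y ⟶ chuTensorNeg A B) :
    A.pairing (snd x) =
      rot A.pos B.pos Y ≫ B.pairing (fst x) := by
  rw [← cancel_epi (α_ A.pos B.pos Y).hom, snd, fst, ← uncurry_comp_chuTensorLegA,
    ← uncurry_comp_chuTensorLegB, Category.assoc, Category.assoc, negFst_comp_legB]

end TensorNeg

section

/-- A copy of `chuUnit` whose components unfold. -/
abbrev unit : Chu C Ω where
  pos := 𝟙_ C
  neg := Ω
  pair := (λ_ Ω).hom

variable {A B E F A' B' : Chu C Ω} {Y Z : C}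

lemma pairing_unit (x : Y ⟶ Ω) : (unit (C := C) (Ω := Ω)).pairing x = (λ_ Y).hom ≫ x := by
  simp [pairing]

/-- The action of `f ⊠ g` on generalized elements of negative parts. -/
noncomputable def mapElt (f : A ⟶ A') (g : B ⟶ B') (x : Y ⟶ chuTensorNeg A' B') :
    Y ⟶ chuTensorNeg A B :=
  lift (Y ◁ ChuHom.pos f ≫ fst x ≫ ChuHom.neg g) (ChuHom.pos g ▷ Y ≫ snd x ≫ ChuHom.neg f) (by
    rw [pairing_comp, pairing_neg, pairing_snd, pairing_comp, pairing_neg]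
    rw [← Category.assoc, ← Category.assoc, Category.assoc _ _ (rot _ _ _), rot_naturality]
    simp only [Category.assoc])

/-- The action of the associator on generalized elements of negative parts. -/
noncomputable def assocElt (x : Y ⟶ chuTensorNeg A (tens B E)) :
    Y ⟶ chuTensorNeg (tens A B) E :=
  lift (A := tens A B) ((α_ Y A.pos B.pos).inv ≫ fst (fst x))
    (lift ((α_ E.pos Y A.pos).hom ≫ snd (fst x)) ((α_ B.pos E.pos Y).inv ≫ snd x) (by
      rw [pairing_comp, pairing_comp, pairing_snd, pairing_tens,
        ← reassoc_of% rot_tensor_middle A.pos B.pos E.pos Y])) (by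
    rw [pairing_tens, snd_lift, pairing_comp, pairing_comp, pairing_snd, pairing_tens,
      pairing_snd, ← reassoc_of% rot_rot A.pos B.pos E.pos Y,
      ← reassoc_of% rot_tensor_middle A.pos B.pos E.pos Y])

/-- The action of the inverse associator on generalized elements of negative parts. -/
noncomputable def assocInvElt (x : Y ⟶ chuTensorNeg (tens A B) E) :
    Y ⟶ chuTensorNeg A (tens B E) :=
  lift (B := tens B E)
    (lift ((α_ Y A.pos B.pos).hom ≫ fst x) ((α_ E.pos Y A.pos).inv ≫ fst (snd x)) (by
      have h := pairing_snd x
      rw [pairing_tens, pairing_snd] at h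
      rw [← cancel_epi ((α_ A.pos B.pos (E.pos ⊗ Y)).hom ≫ rot A.pos B.pos (E.pos ⊗ Y) ≫
        B.pos ◁ (α_ E.pos Y A.pos).hom), pairing_comp, pairing_comp]
      simp only [Category.assoc]
      rw [reassoc_of% rot_rot A.pos B.pos E.pos Y]
      simpa using h))
    ((α_ B.pos E.pos Y).hom ≫ snd (snd x)) (by
    rw [pairing_tens, snd_lift, pairing_comp, pairing_comp, pairing_snd,
      ← cancel_epi (A.pos ◁ (α_ B.pos E.pos Y).inv),
      reassoc_of% rot_tensor_middle A.pos B.pos E.pos Y]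
    simp)

/-- The action of the left unitor on generalized elements of negative parts. -/
noncomputable def leftUnitorElt (x : Y ⟶ A.neg) : Y ⟶ chuTensorNeg unit A :=
  lift (A := unit) ((ρ_ Y).hom ≫ x) (A.pairing x) (by
    rw [pairing_comp]
    simp [pairing, rot])

/-- The action of the inverse left unitor on generalized elements of negative parts. -/
noncomputable def leftUnitorInvElt (x : Y ⟶ chuTensorNeg unit A) : Y ⟶ A.neg :=
  (ρ_ Y).inv ≫ fst x

/-- The action of the right unitor on generalized elements of negative parts. -/
noncomputable def rightUnitorElt (x : Y ⟶ A.neg) : Y ⟶ chuTensorNeg A unit :=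
  lift (B := unit) ((β_ Y A.pos).hom ≫ A.pairing x) ((λ_ Y).hom ≫ x) (by
    rw [pairing_comp, pairing_comp, reassoc_of% rot_braiding A.pos (𝟙_ C) Y]
    simp [pairing])

/-- The action of the inverse right unitor on generalized elements of negative parts. -/
noncomputable def rightUnitorInvElt (x : Y ⟶ chuTensorNeg A unit) : Y ⟶ A.neg :=
  (λ_ Y).inv ≫ snd x

/-- The action of the braiding on generalized elements of negative parts. -/
noncomputable def braidElt (x : Y ⟶ chuTensorNeg B A) : Y ⟶ chuTensorNeg A B :=
  lift ((β_ Y A.pos).hom ≫ snd x) ((β_ B.pos Y).hom ≫ fst x) (by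
    rw [pairing_comp, pairing_comp, pairing_snd, reassoc_of% rot_braiding_rot A.pos B.pos Y])

@[simp] lemma fst_mapElt (f : A ⟶ A') (g : B ⟶ B') (x : Y ⟶ chuTensorNeg A' B') :
    fst (mapElt f g x) = Y ◁ ChuHom.pos f ≫ fst x ≫ ChuHom.neg g := fst_lift _ _ _

@[simp] lemma snd_mapElt (f : A ⟶ A') (g : B ⟶ B') (x : Y ⟶ chuTensorNeg A' B') :
    snd (mapElt f g x) = ChuHom.pos g ▷ Y ≫ snd x ≫ ChuHom.neg f := snd_lift _ _ _

@[simp] lemma fst_assocElt (x : Y ⟶ chuTensorNeg A (tens B E)) :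
    fst (A := tens A B) (assocElt x) = (α_ Y A.pos B.pos).inv ≫ fst (fst x) := fst_lift _ _ _

@[simp] lemma fst_snd_assocElt (x : Y ⟶ chuTensorNeg A (tens B E)) :
    fst (snd (A := tens A B) (assocElt x)) = (α_ E.pos Y A.pos).hom ≫ snd (fst x) := by
  simp [assocElt]

@[simp] lemma snd_snd_assocElt (x : Y ⟶ chuTensorNeg A (tens B E)) :
    snd (snd (A := tens A B) (assocElt x)) = (α_ B.pos E.pos Y).inv ≫ snd x := by
  simp [assocElt]

@[simp] lemma fst_leftUnitorElt (x : Y ⟶ A.neg) :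
    fst (A := unit) (leftUnitorElt x) = (ρ_ Y).hom ≫ x := fst_lift _ _ _

@[simp] lemma snd_leftUnitorElt (x : Y ⟶ A.neg) :
    snd (A := unit) (leftUnitorElt x) = A.pairing x := snd_lift _ _ _

@[simp] lemma fst_rightUnitorElt (x : Y ⟶ A.neg) :
    fst (B := unit) (rightUnitorElt x) = (β_ Y A.pos).hom ≫ A.pairing x := fst_lift _ _ _

@[simp] lemma snd_rightUnitorElt (x : Y ⟶ A.neg) :
    snd (B := unit) (rightUnitorElt x) = (λ_ Y).hom ≫ x := snd_lift _ _ _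

@[simp] lemma fst_braidElt (x : Y ⟶ chuTensorNeg B A) :
    fst (braidElt x) = (β_ Y A.pos).hom ≫ snd x := fst_lift _ _ _

@[simp] lemma snd_braidElt (x : Y ⟶ chuTensorNeg B A) :
    snd (braidElt x) = (β_ B.pos Y).hom ≫ fst x := snd_lift _ _ _

@[simp] lemma comp_lift (f : Z ⟶ Y) (g : Y ⊗ A.pos ⟶ B.neg) (h : B.pos ⊗ Y ⟶ A.neg)
    (w : A.pairing h = rot A.pos B.pos Y ≫ B.pairing g) :
    f ≫ lift g h w = lift (f ▷ A.pos ≫ g) (B.pos ◁ f ≫ h) (by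
      rw [pairing_comp, pairing_comp, w, reassoc_of% rot_naturality_right]) := by
  apply neg_ext <;> simp [fst_comp, snd_comp]

@[simp] lemma comp_mapElt (f : A ⟶ A') (g : B ⟶ B') (x : Y ⟶ chuTensorNeg A' B') (a : Z ⟶ Y) :
    a ≫ mapElt f g x = mapElt f g (a ≫ x) := by
  apply neg_ext <;> simp [mapElt, fst_comp, snd_comp, whisker_exchange_assoc]

@[simp] lemma comp_assocElt (x : Y ⟶ chuTensorNeg A (tens B E)) (a : Z ⟶ Y) :
    a ≫ assocElt x = assocElt (a ≫ x) := by
  apply neg_ext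
  · simp [assocElt, fst_comp, snd_comp]
  · apply neg_ext <;> simp [assocElt, fst_comp, snd_comp]

@[simp] lemma comp_assocInvElt (x : Y ⟶ chuTensorNeg (tens A B) E) (a : Z ⟶ Y) :
    a ≫ assocInvElt x = assocInvElt (a ≫ x) := by
  apply neg_ext
  · apply neg_ext <;> simp [assocInvElt, fst_comp, snd_comp]
  · simp [assocInvElt, fst_comp, snd_comp]

@[simp] lemma comp_leftUnitorElt (x : Y ⟶ A.neg) (a : Z ⟶ Y) :
    a ≫ leftUnitorElt x = leftUnitorElt (a ≫ x) := by
  apply neg_ext <;> simp [leftUnitorElt, pairing_comp]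

@[simp] lemma comp_leftUnitorInvElt (x : Y ⟶ chuTensorNeg unit A) (a : Z ⟶ Y) :
    a ≫ leftUnitorInvElt x = leftUnitorInvElt (a ≫ x) := by
  simp [leftUnitorInvElt, fst_comp]

@[simp] lemma comp_rightUnitorElt (x : Y ⟶ A.neg) (a : Z ⟶ Y) :
    a ≫ rightUnitorElt x = rightUnitorElt (a ≫ x) := by
  apply neg_ext <;> simp [rightUnitorElt, pairing_comp]

@[simp] lemma comp_rightUnitorInvElt (x : Y ⟶ chuTensorNeg A unit) (a : Z ⟶ Y) :
    a ≫ rightUnitorInvElt x = rightUnitorInvElt (a ≫ x) := by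
  simp [rightUnitorInvElt, snd_comp]

@[simp] lemma comp_braidElt (x : Y ⟶ chuTensorNeg B A) (a : Z ⟶ Y) :
    a ≫ braidElt x = braidElt (a ≫ x) := by
  apply neg_ext <;> simp [braidElt, fst_comp, snd_comp]

lemma assocInvElt_assocElt (x : Y ⟶ chuTensorNeg A (tens B E)) :
    assocInvElt (assocElt x) = x := by
  apply neg_ext
  · apply neg_ext <;> simp [assocInvElt, assocElt]
  · simp [assocInvElt, assocElt]

lemma assocElt_assocInvElt (x : Y ⟶ chuTensorNeg (tens A B) E) :
    assocElt (assocInvElt x) = x := by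
  apply neg_ext
  · simp [assocInvElt, assocElt]
  · apply neg_ext <;> simp [assocInvElt, assocElt]

lemma leftUnitorInvElt_leftUnitorElt (x : Y ⟶ A.neg) :
    leftUnitorInvElt (leftUnitorElt x) = x := by
  simp [leftUnitorInvElt, leftUnitorElt]

lemma leftUnitorElt_leftUnitorInvElt (x : Y ⟶ chuTensorNeg unit A) :
    leftUnitorElt (leftUnitorInvElt x) = x := by
  apply neg_ext
  · simp [leftUnitorInvElt, leftUnitorElt]
  · have h := pairing_snd x
    rw [pairing_unit] at h
    rw [leftUnitorElt, snd_lift, leftUnitorInvElt, pairing_comp, ← cancel_epi (λ_ _).hom, h]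
    simp [rot]

lemma rightUnitorInvElt_rightUnitorElt (x : Y ⟶ A.neg) :
    rightUnitorInvElt (rightUnitorElt x) = x := by
  simp [rightUnitorInvElt, rightUnitorElt]

lemma rightUnitorElt_rightUnitorInvElt (x : Y ⟶ chuTensorNeg A unit) :
    rightUnitorElt (rightUnitorInvElt x) = x := by
  apply neg_ext
  · have h := pairing_snd x
    rw [pairing_unit] at h
    rw [rightUnitorElt, fst_lift, rightUnitorInvElt, pairing_comp, h, rot, Category.assoc,
      BraidedCategory.braiding_naturality_right_assoc]
    simp
  · simp [rightUnitorInvElt, rightUnitorElt]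

lemma braidElt_braidElt (x : Y ⟶ chuTensorNeg A B) : braidElt (braidElt x) = x := by
  apply neg_ext <;> simp [braidElt]

end

section Monoidal

variable (A B E : Chu C Ω)

/-- The tensor product `f ⊠ g` of morphisms. -/
noncomputable def map {A B A' B' : Chu C Ω} (f : A ⟶ A') (g : B ⟶ B') :
    tens A B ⟶ tens A' B' :=
  homMk (ChuHom.pos f ⊗ₘ ChuHom.pos g) (mapElt f g (𝟙 _)) (by
    rw [pairing_tens, pairing_tens, mapElt, snd_lift, pairing_comp, pairing_neg,
      tensorHom_def']
    simp)

/-- The associator of `⊠`. -/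
noncomputable def assoc : tens (tens A B) E ≅ tens A (tens B E) where
  hom := homMk (α_ A.pos B.pos E.pos).hom (assocElt (𝟙 _)) (by
    rw [pairing_tens, pairing_tens, pairing_tens, assocElt, snd_lift, snd_lift, pairing_comp]
    simp)
  inv := homMk (α_ A.pos B.pos E.pos).inv (assocInvElt (𝟙 _)) (by
    rw [pairing_tens, pairing_tens, pairing_tens, assocInvElt, snd_lift, pairing_comp]
    simp)
  hom_inv_id := hom_ext (by simp) (by
    simp [comp_assocElt, assocElt_assocInvElt])
  inv_hom_id := hom_ext (by simp) (by
    simp [comp_assocInvElt, assocInvElt_assocElt])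

/-- The left unitor of `⊠`. -/
noncomputable def lUnitor : tens unit A ≅ A where
  hom := homMk (λ_ A.pos).hom (leftUnitorElt (𝟙 _)) (by
    rw [pairing_tens, leftUnitorElt, snd_lift, pairing_unit]
    simp)
  inv := homMk (λ_ A.pos).inv (leftUnitorInvElt (𝟙 _)) (by
    rw [pairing_tens, pairing_snd, leftUnitorInvElt, pairing_comp]
    simp [rot])
  hom_inv_id := hom_ext (by simp) (by
    simp [comp_leftUnitorElt, leftUnitorElt_leftUnitorInvElt])
  inv_hom_id := hom_ext (by simp) (by
    simp [comp_leftUnitorInvElt, leftUnitorInvElt_leftUnitorElt])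

/-- The right unitor of `⊠`. -/
noncomputable def rUnitor : tens A unit ≅ A where
  hom := homMk (ρ_ A.pos).hom (rightUnitorElt (𝟙 _)) (by
    rw [pairing_tens, rightUnitorElt, snd_lift, pairing_comp]
    simp)
  inv := homMk (ρ_ A.pos).inv (rightUnitorInvElt (𝟙 _)) (by
    rw [pairing_tens, rightUnitorInvElt, pairing_comp]
    simp)
  hom_inv_id := hom_ext (by simp) (by
    simp [comp_rightUnitorElt, rightUnitorElt_rightUnitorInvElt])
  inv_hom_id := hom_ext (by simp) (by
    simp [comp_rightUnitorInvElt, rightUnitorInvElt_rightUnitorElt])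

/-- The braiding of `⊠`. -/
noncomputable def braid : tens A B ≅ tens B A where
  hom := homMk (β_ A.pos B.pos).hom (braidElt (𝟙 _)) (by
    rw [pairing_tens, pairing_tens, braidElt, snd_lift, pairing_comp, pairing_snd, rot_eq]
    simp [← MonoidalCategory.comp_whiskerRight_assoc])
  inv := homMk (β_ B.pos A.pos).hom (braidElt (𝟙 _)) (by
    rw [pairing_tens, pairing_tens, braidElt, snd_lift, pairing_comp, pairing_snd, rot_eq]
    simp [← MonoidalCategory.comp_whiskerRight_assoc])
  hom_inv_id := hom_ext (by simp) (by simp [comp_braidElt, braidElt_braidElt])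
  inv_hom_id := hom_ext (by simp) (by simp [comp_braidElt, braidElt_braidElt])

variable {A B E F A' B' E' : Chu C Ω}

lemma map_id : map (𝟙 A) (𝟙 B) = 𝟙 (tens A B) := by
  refine hom_ext (by simp [map]) ?_
  apply neg_ext <;> simp [map, mapElt]

lemma map_comp_map {A'' B'' : Chu C Ω} (f : A ⟶ A') (g : B ⟶ B') (h : A' ⟶ A'') (k : B' ⟶ B'') :
    map f g ≫ map h k = map (f ≫ h) (g ≫ k) := by
  refine hom_ext (by simp [map]) ?_
  simp only [map, comp_neg, homMk_neg, comp_mapElt, Category.comp_id]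
  apply neg_ext <;> simp [mapElt]

lemma assoc_naturality (f : A ⟶ A') (g : B ⟶ B') (h : E ⟶ E') :
    map (map f g) h ≫ (assoc A' B' E').hom = (assoc A B E).hom ≫ map f (map g h) := by
  refine hom_ext (by simp [map, assoc]) ?_
  simp only [map, assoc, comp_neg, homMk_neg, comp_mapElt, comp_assocElt, Category.comp_id]
  apply neg_ext
  · simp [fst_comp]
    rw [tensorHom_def', MonoidalCategory.whiskerLeft_comp_assoc]
  · apply neg_ext
    · simp [fst_comp, snd_comp]
      rw [← associator_naturality_right_assoc, Iso.hom_inv_id_assoc, whisker_exchange_assoc]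
      simp
    · simp [snd_comp]
      simp [MonoidalCategory.tensorHom_def]

lemma lUnitor_naturality (f : A ⟶ B) :
    map (𝟙 unit) f ≫ (lUnitor B).hom = (lUnitor A).hom ≫ f := by
  refine hom_ext (by simp [map, lUnitor]) ?_
  simp only [map, lUnitor, comp_neg, homMk_neg, comp_mapElt, comp_leftUnitorElt, Category.comp_id]
  apply neg_ext <;> simp [← pairing_neg]

lemma rUnitor_naturality (f : A ⟶ B) :
    map f (𝟙 unit) ≫ (rUnitor B).hom = (rUnitor A).hom ≫ f := by
  refine hom_ext (by simp [map, rUnitor]) ?_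
  simp only [map, rUnitor, comp_neg, homMk_neg, comp_mapElt, comp_rightUnitorElt, Category.comp_id]
  apply neg_ext <;> simp [← pairing_neg]

lemma pentagon : map (assoc A B E).hom (𝟙 F) ≫ (assoc A (tens B E) F).hom ≫
      map (𝟙 A) (assoc B E F).hom = (assoc (tens A B) E F).hom ≫ (assoc A B (tens E F)).hom := by
  refine hom_ext (by simp [map, assoc]) ?_
  simp only [map, assoc, comp_neg, homMk_neg, comp_mapElt, comp_assocElt, Category.comp_id]
  apply neg_ext
  · simp [fst_comp]
  · apply neg_ext
    · simp [fst_comp, snd_comp]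
    · apply neg_ext
      · simp [fst_comp, snd_comp]
      · simp [snd_comp]

lemma triangle : (assoc A unit B).hom ≫ map (𝟙 A) (lUnitor B).hom =
    map (rUnitor A).hom (𝟙 B) := by
  refine hom_ext (by simp [map, assoc, lUnitor, rUnitor]) ?_
  simp only [map, assoc, lUnitor, rUnitor, comp_neg, homMk_neg, comp_assocElt, Category.comp_id]
  apply neg_ext
  · simp
  · apply neg_ext
    · simp
      rw [pairing_snd, ← reassoc_of% rot_braiding B.pos A.pos,
        reassoc_of% rot_braiding_rot B.pos A.pos]
      simp [← MonoidalCategory.whiskerLeft_comp_assoc]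
    · simp

lemma braid_naturality (f : A ⟶ A') (g : B ⟶ B') :
    map f g ≫ (braid A' B').hom = (braid A B).hom ≫ map g f := by
  refine hom_ext (by simp [map, braid]) ?_
  simp only [map, braid, comp_neg, homMk_neg, comp_mapElt, comp_braidElt, Category.comp_id]
  apply neg_ext <;> simp

lemma hexagon : (assoc A B E).hom ≫ (braid A (tens B E)).hom ≫ (assoc B E A).hom =
    map (braid A B).hom (𝟙 E) ≫ (assoc B A E).hom ≫ map (𝟙 B) (braid A E).hom := by
  refine hom_ext (by simp [map, assoc, braid]) ?_
  simp only [map, assoc, braid, comp_neg, homMk_neg, comp_mapElt, comp_assocElt, comp_braidElt,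
    Category.comp_id]
  apply neg_ext
  · simp [fst_comp]
    simp [← MonoidalCategory.whiskerLeft_comp_assoc]
  · apply neg_ext
    · simp [snd_comp]
      simp [← MonoidalCategory.comp_whiskerRight_assoc]
    · simp
      rw [← BraidedCategory.braiding_tensor_left_hom_assoc,
        ← BraidedCategory.braiding_naturality_left_assoc]
      simp [← MonoidalCategory.comp_whiskerRight_assoc]

end Monoidal

section Instances

/-- The monoidal structure maps on `Chu C Ω` with tensor `⊠`. -/
noncomputable abbrev monoidalStruct : MonoidalCategoryStruct (Chu C Ω) where
  tensorObj A B := tensorObj A B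
  tensorUnit := chuUnit
  tensorHom f g := map f g
  whiskerLeft A _ _ f := map (𝟙 A) f
  whiskerRight f B := map f (𝟙 B)
  associator A B E := assoc A B E
  leftUnitor A := lUnitor A
  rightUnitor A := rUnitor A

/-- The monoidal category `Chu C Ω` with tensor `⊠`. -/
noncomputable abbrev monoidal : MonoidalCategory (Chu C Ω) :=
  letI := monoidalStruct (C := C) (Ω := Ω)
  MonoidalCategory.ofTensorHom
    (id_tensorHom_id := fun _ _ => map_id)
    (tensorHom_comp_tensorHom := fun f g h k => map_comp_map f g h k)
    (associator_naturality := fun f g h => assoc_naturality f g h)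
    (leftUnitor_naturality := fun f => lUnitor_naturality f)
    (rightUnitor_naturality := fun f => rUnitor_naturality f)
    (pentagon := fun _ _ _ _ => pentagon)
    (triangle := fun _ _ => triangle)

attribute [local instance] monoidal

/-- The symmetric monoidal category `Chu C Ω` with tensor `⊠`. -/
noncomputable abbrev symmetric : SymmetricCategory (Chu C Ω) where
  braiding A B := braid A B
  braiding_naturality_right A _ _ f := braid_naturality (𝟙 A) f
  braiding_naturality_left f A := braid_naturality f (𝟙 A)
  hexagon_forward _ _ _ := hexagon
  hexagon_reverse A B E := by
    have h := congrArg Iso.inv (Iso.ext (hexagon (A := E) (B := A) (E := B)) :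
      α_ E A B ≪≫ braid E (tens A B) ≪≫ α_ A B E =
        whiskerRightIso (braid E A) B ≪≫ α_ A E B ≪≫ whiskerLeftIso A (braid E B))
    exact (Category.assoc _ _ _).symm.trans (h.trans (Category.assoc _ _ _))
  symmetry A B := (braid A B).hom_inv_id

end Instances

section InternalHom

variable {A B X X' : Chu C Ω} {Y Z : C}

/-- A copy of `homObj A B` whose components unfold. -/
noncomputable abbrev ihomObj (A B : Chu C Ω) : Chu C Ω where
  pos := pullback (chuHomLegB A B) (chuHomLegA A B)
  neg := A.pos ⊗ B.neg
  pair := (homObj A B).pair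

/-- The component `A⁺ ⊗ Y ⟶ B⁺` of a generalized element of `(A ⊸ B)⁺`. -/
noncomputable def homFst (x : Y ⟶ (ihomObj A B).pos) : A.pos ⊗ Y ⟶ B.pos :=
  MonoidalClosed.uncurry (x ≫ pullback.fst _ _)

/-- The component `B⁻ ⊗ Y ⟶ A⁻` of a generalized element of `(A ⊸ B)⁺`. -/
noncomputable def homSnd (x : Y ⟶ (ihomObj A B).pos) : B.neg ⊗ Y ⟶ A.neg :=
  MonoidalClosed.uncurry (x ≫ pullback.snd _ _)

lemma homFst_comp (f : Z ⟶ Y) (x : Y ⟶ (ihomObj A B).pos) :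
    homFst (f ≫ x) = A.pos ◁ f ≫ homFst x := by
  rw [homFst, homFst, Category.assoc, MonoidalClosed.uncurry_natural_left]

lemma homSnd_comp (f : Z ⟶ Y) (x : Y ⟶ (ihomObj A B).pos) :
    homSnd (f ≫ x) = B.neg ◁ f ≫ homSnd x := by
  rw [homSnd, homSnd, Category.assoc, MonoidalClosed.uncurry_natural_left]

lemma ihomObj_pos_ext {x y : Y ⟶ (ihomObj A B).pos} (h₁ : homFst x = homFst y)
    (h₂ : homSnd x = homSnd y) : x = y :=
  pullback.hom_ext (MonoidalClosed.uncurry_injective h₁) (MonoidalClosed.uncurry_injective h₂)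

lemma uncurry_comp_chuHomLegA (x : Y ⟶ (ihom B.neg).obj A.neg) :
    MonoidalClosed.uncurry (x ≫ chuHomLegA A B) =
      (α_ A.pos B.neg Y).hom ≫ A.pairing (MonoidalClosed.uncurry x) := by
  simp [chuHomLegA, MonoidalClosed.uncurry_natural_left, pairing, MonoidalClosed.uncurry_eq x]

lemma uncurry_comp_chuHomLegB (x : Y ⟶ (ihom A.pos).obj B.pos) :
    MonoidalClosed.uncurry (x ≫ chuHomLegB A B) =
      (α_ A.pos B.neg Y).hom ≫ A.pos ◁ (β_ B.neg Y).hom ≫ (α_ A.pos Y B.neg).inv ≫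
        MonoidalClosed.uncurry x ▷ B.neg ≫ B.pair := by
  simp [chuHomLegB, MonoidalClosed.uncurry_natural_left, MonoidalClosed.uncurry_eq x]
  rw [← MonoidalCategory.whiskerLeft_comp_assoc, BraidedCategory.braiding_naturality_right,
    MonoidalCategory.whiskerLeft_comp_assoc]

lemma pairing_homSnd (x : Y ⟶ (ihomObj A B).pos) :
    A.pairing (homSnd x) = A.pos ◁ (β_ B.neg Y).hom ≫ (α_ A.pos Y B.neg).inv ≫
      homFst x ▷ B.neg ≫ B.pair := by
  rw [← cancel_epi (α_ A.pos B.neg Y).hom, homSnd, homFst, ← uncurry_comp_chuHomLegA,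
    ← uncurry_comp_chuHomLegB, Category.assoc, Category.assoc, pullback.condition]

lemma comp_pair_ihomObj (x : Y ⟶ (ihomObj A B).pos) :
    x ▷ (A.pos ⊗ B.neg) ≫ (ihomObj A B).pair =
      rot Y A.pos B.neg ≫ A.pairing (homSnd x) := by
  rw [rot, Category.assoc, homSnd, ← uncurry_comp_chuHomLegA, Category.assoc,
    ← pullback.condition, MonoidalClosed.uncurry_natural_left,
    ← BraidedCategory.braiding_naturality_left_assoc]
  rfl

/-- A generalized element of `(A ⊸ B)⁺` from compatible components. -/
noncomputable def homLift (g : A.pos ⊗ Y ⟶ B.pos) (h : B.neg ⊗ Y ⟶ A.neg)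
    (w : A.pairing h = A.pos ◁ (β_ B.neg Y).hom ≫ (α_ A.pos Y B.neg).inv ≫
      g ▷ B.neg ≫ B.pair) :
    Y ⟶ (ihomObj A B).pos :=
  pullback.lift (MonoidalClosed.curry g) (MonoidalClosed.curry h) (by
    apply MonoidalClosed.uncurry_injective
    rw [uncurry_comp_chuHomLegA, uncurry_comp_chuHomLegB]
    simp [w])

@[simp] lemma homFst_homLift (g : A.pos ⊗ Y ⟶ B.pos) (h : B.neg ⊗ Y ⟶ A.neg)
    (w : A.pairing h = A.pos ◁ (β_ B.neg Y).hom ≫ (α_ A.pos Y B.neg).inv ≫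
      g ▷ B.neg ≫ B.pair) :
    homFst (homLift g h w) = g := by
  rw [homFst, homLift, pullback.lift_fst, MonoidalClosed.uncurry_curry]

@[simp] lemma homSnd_homLift (g : A.pos ⊗ Y ⟶ B.pos) (h : B.neg ⊗ Y ⟶ A.neg)
    (w : A.pairing h = A.pos ◁ (β_ B.neg Y).hom ≫ (α_ A.pos Y B.neg).inv ≫
      g ▷ B.neg ≫ B.pair) :
    homSnd (homLift g h w) = h := by
  rw [homSnd, homLift, pullback.lift_snd, MonoidalClosed.uncurry_curry]

@[simp] lemma pairing_id (A : Chu C Ω) : A.pairing (𝟙 A.neg) = A.pair := by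
  simp [pairing]

/-- The transpose `X ⟶ A ⊸ B` of a morphism `A ⊠ X ⟶ B`. -/
noncomputable def transpose (f : tens A X ⟶ B) : X ⟶ ihomObj A B :=
  homMk (homLift (ChuHom.pos f) ((β_ B.neg X.pos).hom ≫ snd (ChuHom.neg f)) (by
      have h := pairing_neg f (𝟙 _)
      rw [Category.id_comp, pairing_tens, pairing_id] at h
      rw [pairing_comp, ← h, Iso.inv_hom_id_assoc]))
    ((β_ A.pos B.neg).hom ≫ fst (ChuHom.neg f)) (by
      rw [pairing_id (ihomObj A B), comp_pair_ihomObj, homSnd_homLift, pairing_comp,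
        pairing_comp, pairing_snd, reassoc_of% rot_braiding_rot X.pos A.pos B.neg])

/-- The morphism `A ⊠ X ⟶ B` with a given transpose `X ⟶ A ⊸ B`. -/
noncomputable def untranspose (g : X ⟶ ihomObj A B) : tens A X ⟶ B :=
  homMk (homFst (ChuHom.pos g))
    (lift ((β_ B.neg A.pos).hom ≫ ChuHom.neg g)
      ((β_ X.pos B.neg).hom ≫ homSnd (ChuHom.pos g)) (by
      have h := pairing_neg g (𝟙 _)
      rw [Category.id_comp, pairing_id, comp_pair_ihomObj] at h
      rw [pairing_comp, pairing_comp, h, reassoc_of% rot_braiding_rot A.pos X.pos B.neg]))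
    (by
      rw [pairing_tens, snd_lift, pairing_comp, pairing_homSnd, pairing_id]
      simp [← MonoidalCategory.whiskerLeft_comp_assoc])

/-- The bijection between morphisms `A ⊠ X ⟶ B` and morphisms `X ⟶ A ⊸ B`. -/
noncomputable def transposeEquiv (A X B : Chu C Ω) : (tens A X ⟶ B) ≃ (X ⟶ ihomObj A B) where
  toFun := transpose
  invFun := untranspose
  left_inv f := hom_ext (by simp [transpose, untranspose]) (by
    apply neg_ext <;> simp [transpose, untranspose])
  right_inv g := hom_ext (by apply ihomObj_pos_ext <;> simp [transpose, untranspose])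
    (by simp [transpose, untranspose])

lemma transpose_map_comp (f : X' ⟶ X) (g : tens A X ⟶ B) :
    transpose (map (𝟙 A) f ≫ g) = f ≫ transpose g := by
  refine hom_ext ?_ ?_
  · apply ihomObj_pos_ext <;> simp [transpose, map, homFst_comp, homSnd_comp]
  · simp [transpose, map]

end InternalHom

end Chu

/-- The symmetric monoidal category `Chu(C,Ω)` (with tensor `⊠` and unit
`(I, Ω, λ)`) is monoidal closed: for every object `A` the functor `A ⊠ −` has a right
adjoint `A ⊸ −`, whose value at `B` is the object described by `Chu.homObj A B`. -/
theorem chu_monoidal_closed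
    (C : Type u) [Category.{v} C] [MonoidalCategory C] [SymmetricCategory C] (Ω : C)
    [MonoidalClosed C] [Limits.HasPullbacks C] :
    ∃ (M : MonoidalCategory (Chu C Ω)) (_ : @SymmetricCategory (Chu C Ω) _ M),
      (∀ A B : Chu C Ω,
        @MonoidalCategoryStruct.tensorObj (Chu C Ω) _ M.toMonoidalCategoryStruct A B
          = Chu.tensorObj A B) ∧
      (@MonoidalCategoryStruct.tensorUnit (Chu C Ω) _ M.toMonoidalCategoryStruct
          = chuUnit) ∧
      ∀ A : Chu C Ω, ∃ H : Chu C Ω ⥤ Chu C Ω,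
        (∀ B : Chu C Ω, H.obj B = Chu.homObj A B) ∧
        Nonempty (@MonoidalCategory.tensorLeft (Chu C Ω) _ M A ⊣ H) := by
  let M : MonoidalCategory (Chu C Ω) := Chu.monoidal
  refine ⟨M, Chu.symmetric, fun _ _ => rfl, rfl, fun A => ?_⟩
  exact ⟨Adjunction.rightAdjointOfEquiv (F := tensorLeft A) (G_obj := Chu.homObj A)
      (fun X B => Chu.transposeEquiv A X B) (fun _ _ _ f g => Chu.transpose_map_comp f g),
    fun _ => rfl, ⟨Adjunction.adjunctionOfEquivRight _ _⟩⟩
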